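/- Let C be an m×n Cauchon diagram, let x be a white square, and in the Cauchon graph G_C let K_1 : u_1 ⇒ x and K_2 : u_2 ⇒ x be directed paths ending at x with K_2 containing at least one horizontal edge, and let L_1 : x ⇒ c_a and L_2 : x ⇒ c_b be directed paths sharing only the vertex x, where L_1 starts with a horizontal edge and L_2 starts with a vertical edge. Then w(K_1L_1)·w(K_2L_2) = q·w(K_1L_2)·w(K_2L_1), where K L denotes the concatenation of paths K and L. -/

import Mathlib

universe u

/-- Quantum affine space data: a central unit `q` and units `t i j`
satisfying the quantum affine space commutation relations. -/
structure QMData (R : Type u) [Ring R] (m n : ℕ) where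
  q : Rˣ
  t : Fin m → Fin n → Rˣ
  q_central : ∀ r : R, (q : R) * r = r * (q : R)
  row_rel : ∀ (i : Fin m) ⦃j j' : Fin n⦄, j < j' →
    (t i j : R) * (t i j' : R) = (q : R) * ((t i j' : R) * (t i j : R))
  col_rel : ∀ ⦃i i' : Fin m⦄ (j : Fin n), i < i' →
    (t i j : R) * (t i' j : R) = (q : R) * ((t i' j : R) * (t i j : R))
  mixed_rel : ∀ ⦃i i' : Fin m⦄ ⦃j j' : Fin n⦄, i < i' → j ≠ j' →
    (t i j : R) * (t i' j' : R) = (t i' j' : R) * (t i j : R)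

/-- `white i j = true` means the square `(i,j)` is white.  The Cauchon
condition: for every black square, either every square above it or every
square to its left is also black. -/
def IsCauchon {m n : ℕ} (white : Fin m → Fin n → Bool) : Prop :=
  ∀ i j, white i j = false →
    (∀ i' : Fin m, i' < i → white i' j = false) ∨
    (∀ j' : Fin n, j' < j → white i j' = false)

/-- Vertices of the Cauchon graph: white squares, row vertices `r_i`,
column vertices `c_j`. -/
inductive CVertex (m n : ℕ) where
  | sq : Fin m → Fin n → CVertex m n
  | row : Fin m → CVertex m n
  | col : Fin n → CVertex m n
deriving DecidableEq

/-- Directed edges of the Cauchon graph. -/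
inductive CEdge {m n : ℕ} (white : Fin m → Fin n → Bool) :
    CVertex m n → CVertex m n → Prop where
  | fromRow (i : Fin m) (k : Fin n) :
      white i k = true → (∀ k' : Fin n, k < k' → white i k' = false) →
      CEdge white (.row i) (.sq i k)
  | toCol (i : Fin m) (j : Fin n) :
      white i j = true → (∀ i' : Fin m, i < i' → white i' j = false) →
      CEdge white (.sq i j) (.col j)
  | horiz (i : Fin m) (k j : Fin n) :
      j < k → white i k = true → white i j = true →
      (∀ j' : Fin n, j < j' → j' < k → white i j' = false) →
      CEdge white (.sq i k) (.sq i j)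
  | vert (i i' : Fin m) (j : Fin n) :
      i < i' → white i j = true → white i' j = true →
      (∀ l : Fin m, i < l → l < i' → white l j = false) →
      CEdge white (.sq i j) (.sq i' j)

/-- The weight of an edge of the Cauchon graph (1 on non-edges). -/
def wt {R : Type u} {m n : ℕ} [Ring R] (D : QMData R m n) :
    CVertex m n → CVertex m n → R
  | .row i, .sq i' k => if i = i' then (D.t i' k : R) else 1
  | .sq i k, .sq i' j =>
      if i = i' ∧ j < k then (↑((D.t i k)⁻¹) * ↑(D.t i j) : R) else 1
  | _, _ => 1

/-- A pair of vertices spans a horizontal edge (edges from `r_i` are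
horizontal; edges between squares are horizontal iff the rows agree). -/
def Horiz {m n : ℕ} : CVertex m n → CVertex m n → Prop
  | .row _, _ => True
  | .sq i _, .sq i' _ => i = i'
  | _, _ => False

/-- `l` is (the list of vertices of) a directed path from `u` to `v`. -/
def IsPathFrom {m n : ℕ} (white : Fin m → Fin n → Bool) (u v : CVertex m n)
    (l : List (CVertex m n)) : Prop :=
  l.Chain' (CEdge white) ∧ l.head? = some u ∧ l.getLast? = some v

/-- The list of (endpoint pairs of the) edges of a path. -/
def steps {m n : ℕ} (l : List (CVertex m n)) : List (CVertex m n × CVertex m n) :=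
  l.zip l.tail

/-- The weight of a path: the ordered product of its edge weights. -/
def pathWeight {R : Type u} {m n : ℕ} [Ring R] (D : QMData R m n)
    (l : List (CVertex m n)) : R :=
  ((steps l).map fun p => wt D p.1 p.2).prod

/-- The number of inversions (length) of a permutation of `Fin k`. -/
def invCount {k : ℕ} (σ : Equiv.Perm (Fin k)) : ℕ :=
  ((Finset.univ : Finset (Fin k × Fin k)).filter fun p => p.1 < p.2 ∧ σ p.2 < σ p.1).card

/-- The quantum determinant of a `k × k` matrix over a (noncommutative) ring. -/
def qdet {R : Type u} [Ring R] {k : ℕ} (q : Rˣ) (N : Matrix (Fin k) (Fin k) R) : R :=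
  ∑ σ : Equiv.Perm (Fin k),
    (-(q : R)) ^ invCount σ * ((List.finRange k).map fun i => N i (σ i)).prod

/-- The path matrix: entry `(i,j)` is the sum of the weights of all directed
paths from `r_i` to `c_j` (zero when there are none). -/
noncomputable def pathMatrix {R : Type u} {m n : ℕ} [Ring R] (D : QMData R m n)
    (white : Fin m → Fin n → Bool) : Matrix (Fin m) (Fin n) R :=
  Matrix.of fun i j =>
    ∑ᶠ p : {l : List (CVertex m n) // IsPathFrom white (.row i) (.col j) l},
      pathWeight D p.1

/-- An `(R_I, C_J)`-path system: paths `P ℓ : r_{i_ℓ} ⇒ c_{j_{σ ℓ}}`. -/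
structure PathSys {m n : ℕ} (white : Fin m → Fin n → Bool) {k : ℕ}
    (ι : Fin k → Fin m) (κ : Fin k → Fin n) where
  σ : Equiv.Perm (Fin k)
  P : Fin k → List (CVertex m n)
  isPath : ∀ l : Fin k, IsPathFrom white (.row (ι l)) (.col (κ (σ l))) (P l)

/-- A path system is vertex-disjoint if no two of its paths share a vertex. -/
def PathSys.VertexDisjoint {m n : ℕ} {white : Fin m → Fin n → Bool} {k : ℕ}
    {ι : Fin k → Fin m} {κ : Fin k → Fin n} (S : PathSys white ι κ) : Prop :=
  ∀ a b : Fin k, a ≠ b → ∀ x : CVertex m n, x ∈ S.P a → x ∈ S.P b → False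

/-- The weight of a path system: the ordered product `w(P₁)⋯w(P_k)`. -/
def PathSys.weight {R : Type u} {m n : ℕ} [Ring R] (D : QMData R m n)
    {white : Fin m → Fin n → Bool} {k : ℕ} {ι : Fin k → Fin m} {κ : Fin k → Fin n}
    (S : PathSys white ι κ) : R :=
  ((List.finRange k).map fun l => pathWeight D (S.P l)).prod

/-- The `q`-sign of a path system: `(-q) ^ ℓ(σ_P)`. -/
def PathSys.sgnq {R : Type u} {m n : ℕ} [Ring R] (D : QMData R m n)
    {white : Fin m → Fin n → Bool} {k : ℕ} {ι : Fin k → Fin m} {κ : Fin k → Fin n}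
    (S : PathSys white ι κ) : R :=
  (-(D.q : R)) ^ invCount S.σ

/-- `X` and `Y` commute up to the factor `q ^ k`. -/
def QMData.QComm {R : Type u} [Ring R] {m n : ℕ} (D : QMData R m n) (X Y : R) (k : ℤ) : Prop :=
  X * Y = ((D.q ^ k : Rˣ) : R) * (Y * X)

/-- The value at a column, transported to the vertices of the graph (`0` at row vertices). -/
def colLift {m n : ℕ} (φ : Fin n → ℤ) : CVertex m n → ℤ
  | .sq _ j => φ j
  | .col j => φ j
  | .row _ => 0

section QComm

variable {R : Type u} [Ring R] {m n : ℕ} (D : QMData R m n)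

theorem QMData.commute_q_zpow (k : ℤ) (r : R) : ((D.q ^ k : Rˣ) : R) * r = r * (D.q ^ k : Rˣ) :=
  (Commute.units_zpow_right (D.q_central r).symm k).symm.eq

variable {D}

theorem QMData.QComm.symm {X Y : R} {k : ℤ} (h : D.QComm X Y k) : D.QComm Y X (-k) := by
  unfold QMData.QComm at *
  rw [h, ← mul_assoc, ← Units.val_mul, ← zpow_add]
  simp

theorem QMData.QComm.one_left (Y : R) : D.QComm 1 Y 0 := by
  simp [QMData.QComm]

theorem QMData.QComm.mul_left {X X' Y : R} {k l : ℤ} (h : D.QComm X Y k) (h' : D.QComm X' Y l) :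
    D.QComm (X * X') Y (k + l) := by
  unfold QMData.QComm at *
  rw [mul_assoc, h', ← mul_assoc X, ← D.commute_q_zpow l X, mul_assoc, ← mul_assoc X, h, add_comm k,
    zpow_add, Units.val_mul]
  simp only [mul_assoc]

theorem QMData.QComm.inv_left {X : Rˣ} {Y : R} {k : ℤ} (h : D.QComm (X : R) Y k) :
    D.QComm ((X⁻¹ : Rˣ) : R) Y (-k) := by
  unfold QMData.QComm at *
  have h1 : Y * X = ((D.q ^ (-k) : Rˣ) : R) * (X * Y) := by
    rw [h, ← mul_assoc, ← Units.val_mul, ← zpow_add]; simp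
  have h2 : Y = ((D.q ^ (-k) : Rˣ) : R) * (X * (Y * (X⁻¹ : Rˣ))) := by
    rw [← mul_assoc (X : R), ← mul_assoc, ← h1, mul_assoc, Units.mul_inv, mul_one]
  conv_lhs => rw [h2]
  rw [← mul_assoc, ← D.commute_q_zpow, mul_assoc, Units.inv_mul_cancel_left]

variable (D) in
theorem QMData.qComm_t (i r : Fin m) (j c : Fin n) :
    D.QComm (D.t i j : R) (D.t r c : R)
      (if i = r then (if j < c then 1 else if c < j then -1 else 0)
        else if j = c then (if i < r then 1 else -1) else 0) := by
  have row (i : Fin m) {j c : Fin n} (h : j < c) : D.QComm (D.t i j : R) (D.t i c : R) 1 := by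
    simpa [QMData.QComm] using D.row_rel i h
  have col {i r : Fin m} (j : Fin n) (h : i < r) : D.QComm (D.t i j : R) (D.t r j : R) 1 := by
    simpa [QMData.QComm] using D.col_rel j h
  rcases lt_trichotomy i r with hi | rfl | hi
  · rw [if_neg hi.ne]
    split_ifs with hj
    · exact hj ▸ col j hi
    · simpa [QMData.QComm] using D.mixed_rel hi hj
  · rw [if_pos rfl]
    rcases lt_trichotomy j c with hj | rfl | hj
    · simpa [hj] using row i hj
    · simp [QMData.QComm]
    · simpa [hj, hj.not_gt] using (row i hj).symm
  · rw [if_neg hi.ne', if_neg hi.not_gt]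
    split_ifs with hj
    · exact hj ▸ (col c hi).symm
    · simpa [QMData.QComm] using (D.mixed_rel hi (Ne.symm hj)).symm

end QComm

section Paths

variable {m n : ℕ} {white : Fin m → Fin n → Bool}

theorem IsPathFrom.cons_iff {u v x y : CVertex m n} {l : List (CVertex m n)} :
    IsPathFrom white u v (x :: y :: l) ↔ x = u ∧ CEdge white x y ∧ IsPathFrom white y v (y :: l) := by
  have h : List.Chain' (CEdge white) (x :: y :: l) ↔
      CEdge white x y ∧ List.Chain' (CEdge white) (y :: l) := List.isChain_cons_cons
  simp only [IsPathFrom, h, List.head?_cons, Option.some.injEq, List.getLast?_cons_cons]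
  tauto

theorem IsPathFrom.singleton_iff {u v x : CVertex m n} :
    IsPathFrom white u v [x] ↔ x = u ∧ x = v := by
  have h : List.Chain' (CEdge white) [x] := List.isChain_singleton x
  simp [IsPathFrom, h]

theorem IsPathFrom.not_nil {u v : CVertex m n} : ¬ IsPathFrom white u v [] := by
  simp [IsPathFrom]

/-- A property that passes along edges and holds at the source of a path holds on the path. -/
theorem IsPathFrom.forward {G : CVertex m n → Prop} {M : List (CVertex m n)} {u v : CVertex m n}
    (hM : IsPathFrom white u v M) (hu : G u)
    (hG : ∀ w ∈ M, ∀ w' ∈ M, CEdge white w w' → G w → G w') : ∀ w ∈ M, G w := by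
  induction M generalizing u with
  | nil => simp
  | cons x l ih =>
    cases l with
    | nil => simpa [(IsPathFrom.singleton_iff.1 hM).1] using hu
    | cons y l =>
      obtain ⟨rfl, he, hl⟩ := IsPathFrom.cons_iff.1 hM
      intro w hw
      rcases List.mem_cons.1 hw with rfl | hw
      · exact hu
      · exact ih hl (hG _ (by simp) _ (by simp) he hu)
          (fun w h w' h' => hG w (List.mem_cons_of_mem _ h) w' (List.mem_cons_of_mem _ h')) w hw

/-- A property that passes backwards along edges and holds at the target of a path holds on the
path. -/
theorem IsPathFrom.backward {G : CVertex m n → Prop} {M : List (CVertex m n)} {u v : CVertex m n}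
    (hM : IsPathFrom white u v M) (hv : G v)
    (hG : ∀ w w', CEdge white w w' → G w' → G w) : ∀ w ∈ M, G w := by
  induction M generalizing u with
  | nil => simp
  | cons x l ih =>
    cases l with
    | nil => simpa [(IsPathFrom.singleton_iff.1 hM).2] using hv
    | cons y l =>
      obtain ⟨rfl, he, hl⟩ := IsPathFrom.cons_iff.1 hM
      intro w hw
      rcases List.mem_cons.1 hw with rfl | hw
      · exact hG _ _ he (ih hl y (by simp))
      · exact ih hl w hw

theorem IsPathFrom.head_mem {u v : CVertex m n} {M : List (CVertex m n)}
    (hM : IsPathFrom white u v M) : u ∈ M :=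
  List.mem_of_mem_head? hM.2.1

theorem IsPathFrom.last_mem {u v : CVertex m n} {M : List (CVertex m n)}
    (hM : IsPathFrom white u v M) : v ∈ M :=
  List.mem_of_getLast? hM.2.2

/-- The vertices that are weakly south-west of the square `(i, j)`. -/
def SouthWest (i : Fin m) (j : Fin n) : CVertex m n → Prop
  | .sq r c => i ≤ r ∧ c ≤ j
  | .col c => c ≤ j
  | .row _ => False

/-- The vertices that are weakly north-east of the square `(i, j)`. -/
def NorthEast (i : Fin m) (j : Fin n) : CVertex m n → Prop
  | .sq r c => r ≤ i ∧ j ≤ c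
  | .col _ => False
  | .row _ => True

theorem IsPathFrom.southWest {i : Fin m} {j : Fin n} {v : CVertex m n} {M : List (CVertex m n)}
    (hM : IsPathFrom white (.sq i j) v M) : ∀ w ∈ M, SouthWest i j w := by
  refine hM.forward ⟨le_rfl, le_rfl⟩ ?_
  rintro w - w' - he hw
  cases he with
  | fromRow => exact hw.elim
  | toCol => exact hw.2
  | horiz r k c h => exact ⟨hw.1, h.le.trans hw.2⟩
  | vert r r' c h => exact ⟨hw.1.trans h.le, hw.2⟩

theorem IsPathFrom.northEast {i : Fin m} {j : Fin n} {u : CVertex m n} {M : List (CVertex m n)}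
    (hM : IsPathFrom white u (.sq i j) M) : ∀ w ∈ M, NorthEast i j w := by
  refine hM.backward ⟨le_rfl, le_rfl⟩ ?_
  rintro w w' he hw
  cases he with
  | fromRow => trivial
  | toCol => exact hw.elim
  | horiz r k c h => exact ⟨hw.1, hw.2.trans h.le⟩
  | vert r r' c h => exact ⟨h.le.trans hw.1, hw.2⟩

/-- A path to `(i, j)` with a horizontal edge starts at a row vertex or strictly to the right of
column `j`. -/
theorem IsPathFrom.source_of_horiz {i : Fin m} {j : Fin n} {u : CVertex m n}
    {M : List (CVertex m n)} (hM : IsPathFrom white u (.sq i j) M)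
    (hh : ∃ p ∈ steps M, Horiz p.1 p.2) : (∃ r, u = .row r) ∨ ∃ r k, u = .sq r k ∧ j < k := by
  induction M generalizing u with
  | nil => exact (IsPathFrom.not_nil hM).elim
  | cons x l ih =>
    cases l with
    | nil => simp [steps] at hh
    | cons y l =>
      obtain ⟨rfl, he, hl⟩ := IsPathFrom.cons_iff.1 hM
      have hy := hl.northEast y (by simp)
      have hstep : Horiz x y ∨ ∃ p ∈ steps (y :: l), Horiz p.1 p.2 := by
        simpa [steps, or_and_right, exists_or] using hh
      cases he with
      | fromRow r => exact .inl ⟨r, rfl⟩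
      | toCol => exact hy.elim
      | horiz r k c h => exact .inr ⟨r, k, rfl, hy.2.trans_lt h⟩
      | vert r r' c h =>
        rcases hstep with h' | h'
        · exact (h.ne h').elim
        · rcases ih hl h' with ⟨_, h2⟩ | ⟨_, _, h2, h3⟩
          · cases h2
          · cases h2
            exact .inr ⟨_, _, rfl, h3⟩

/-- If a square strictly left of a path is joined by an edge to a square off that path, then the
latter is strictly left of the path as well: paths in a Cauchon graph do not cross. -/
theorem IsPathFrom.left_of_edge (hC : IsCauchon white) {xi i i' : Fin m} {xj j j' : Fin n}
    {v : CVertex m n} {L : List (CVertex m n)} (hL : IsPathFrom white (.sq xi xj) v L)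
    (hi : xi ≤ i) (hleft : ∀ r c, CVertex.sq r c ∈ L → r ≤ i → j < c)
    (he : CEdge white (.sq i j) (.sq i' j')) (hnot : CVertex.sq i' j' ∉ L) :
    ∀ r c, CVertex.sq r c ∈ L → r ≤ i' → j' < c := by
  cases he with
  | horiz _ _ _ h => exact fun r c hm hr => h.trans (hleft r c hm hr)
  | vert _ _ _ h hw hw' hblack =>
    have key : ∀ w ∈ L, ∀ r c, w = .sq r c → r ≤ i' → j < c := by
      refine hL.forward ?_ ?_
      · rintro r c ⟨⟩ -
        exact hleft xi xj hL.head_mem hi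
      · rintro w hmem0 w' hmem he hw0 r c rfl hr
        cases he with
        | fromRow => exact (hL.southWest _ hmem0).elim
        | vert r0 _ _ h0 => exact hw0 _ _ rfl (h0.le.trans hr)
        | horiz _ k _ hk hwk hwc hb =>
          have hjk := hw0 _ _ rfl hr
          by_contra! hcj
          have hir : i < r := by
            by_contra! hri
            exact (hleft r c hmem hri).not_ge hcj
          rcases hr.lt_or_eq with hri | rfl
          · have hbl := hblack r hir hri
            rcases hcj.lt_or_eq with hcj | rfl
            · rcases hC r j hbl with hu | hl
              · simp [hu i hir] at hw
              · simp [hl c hcj] at hwc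
            · simp [hbl] at hwc
          · rcases hcj.lt_or_eq with hcj | rfl
            · simp [hb j hcj hjk] at hw'
            · exact hnot hmem
    exact fun r c hm hr => key _ hm r c rfl hr

end Paths

section PathWeight

variable {R : Type u} [Ring R] {m n : ℕ} (D : QMData R m n)

theorem pathWeight_cons_cons (x y : CVertex m n) (l : List (CVertex m n)) :
    pathWeight D (x :: y :: l) = wt D x y * pathWeight D (y :: l) := by
  simp [pathWeight, steps]

variable {white : Fin m → Fin n → Bool}

theorem IsPathFrom.pathWeight_append {u v w : CVertex m n} {K L : List (CVertex m n)}
    (hK : IsPathFrom white u v K) (hL : IsPathFrom white v w L) :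
    pathWeight D (K ++ L.tail) = pathWeight D K * pathWeight D L := by
  induction K generalizing u with
  | nil => exact (IsPathFrom.not_nil hK).elim
  | cons x l ih =>
    cases l with
    | nil =>
      have hx := (IsPathFrom.singleton_iff.1 hK).2
      cases L with
      | nil => exact (IsPathFrom.not_nil hL).elim
      | cons y L =>
        have hy : y = v := by simpa using hL.2.1
        simp [hx, hy, pathWeight, steps]
    | cons y l =>
      obtain ⟨rfl, -, hl⟩ := IsPathFrom.cons_iff.1 hK
      have := ih hl
      simp only [List.cons_append] at this ⊢
      rw [pathWeight_cons_cons, pathWeight_cons_cons, this, mul_assoc]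

variable {D}

/-- If the `q`-commutation exponents of the edge weights of a path with `Y` are differences of a
potential, then so is that of the path weight. -/
theorem IsPathFrom.qComm_of_potential {u v : CVertex m n} {M : List (CVertex m n)} {Y : R}
    (hM : IsPathFrom white u v M) (ψ : CVertex m n → ℤ)
    (h : ∀ w ∈ M, ∀ w' ∈ M, CEdge white w w' → D.QComm (wt D w w') Y (ψ w' - ψ w)) :
    D.QComm (pathWeight D M) Y (ψ v - ψ u) := by
  induction M generalizing u with
  | nil => exact (IsPathFrom.not_nil hM).elim
  | cons x l ih =>
    cases l with
    | nil =>
      obtain ⟨rfl, rfl⟩ := IsPathFrom.singleton_iff.1 hM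
      simpa [pathWeight, steps] using QMData.QComm.one_left Y
    | cons y l =>
      obtain ⟨rfl, he, hl⟩ := IsPathFrom.cons_iff.1 hM
      have h1 := ih hl fun w hw w' hw' =>
        h w (List.mem_cons_of_mem _ hw) w' (List.mem_cons_of_mem _ hw')
      have h2 := (h x (by simp) y (by simp) he).mul_left h1
      rw [pathWeight_cons_cons]
      convert h2 using 1
      ring

theorem IsPathFrom.qComm_of_col {u v : CVertex m n} {M : List (CVertex m n)} {Y : R}
    (hM : IsPathFrom white u v M) (φ : Fin n → ℤ)
    (h : ∀ i j, CVertex.sq i j ∈ M → D.QComm (D.t i j : R) Y (φ j)) :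
    D.QComm (pathWeight D M) Y (colLift φ v - colLift φ u) := by
  refine hM.qComm_of_potential _ ?_
  rintro w hw w' hw' he
  cases he with
  | fromRow i k => simpa [wt, colLift] using h i k hw'
  | toCol => simpa [wt, colLift] using QMData.QComm.one_left Y
  | horiz i k j hjk =>
    simpa [wt, colLift, hjk, sub_eq_neg_add] using (h i k hw).inv_left.mul_left (h i j hw')
  | vert i i' j hi => simpa [wt, colLift, hi.ne] using QMData.QComm.one_left Y

/-- The `q`-commutation exponent of `t i j` with the weight of a path `L` to `c_b` all of whose
squares above row `i` are right of column `j`, and whose squares in row `i` are all on the same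
side of column `j`. -/
theorem IsPathFrom.qComm_t {i r : Fin m} {j c b : Fin n} {L : List (CVertex m n)}
    (hL : IsPathFrom white (.sq r c) (.col b) L)
    (habove : ∀ i' j', CVertex.sq i' j' ∈ L → i' < i → j < j')
    (hrow : (∀ j', CVertex.sq i j' ∈ L → j < j') ∨ ∀ j', CVertex.sq i j' ∈ L → j' ≤ j) :
    D.QComm (D.t i j : R) (pathWeight D L) ((if j = b then 1 else 0) - if j = c then 1 else 0) := by
  have key := hL.qComm_of_potential (D := D) (Y := (D.t i j : R))
    (colLift fun k => if j = k then -1 else 0) (by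
      rintro w hw w' hw' he
      cases he with
      | fromRow => exact (hL.southWest _ hw).elim
      | toCol => simpa [wt, colLift] using QMData.QComm.one_left _
      | vert i i' j hi => simpa [wt, colLift, hi.ne] using QMData.QComm.one_left _
      | horiz s k l hlk =>
        have h := (D.qComm_t s i k j).inv_left.mul_left (D.qComm_t s i l j)
        simp only [wt, hlk, and_self, if_true, colLift]
        convert h using 1
        rcases lt_trichotomy s i with hs | rfl | hs
        · have h1 := habove _ _ hw hs
          have h2 := habove _ _ hw' hs
          simp [hs.ne, h1.ne, h1.ne', h2.ne, h2.ne']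
        · rcases hrow with h | h
          · have h1 := h _ hw
            have h2 := h _ hw'
            simp [h1.ne, h2.ne, h1, h2, h1.not_gt, h2.not_gt]
          · have h1 := h _ hw
            have h2 := hlk.trans_le h1
            rcases h1.lt_or_eq with h1 | rfl
            · simp [h1.ne', h2.ne', h1, h2]
            · simp [h2.ne', h2]
        · simp only [hs.ne', hs.not_gt, if_false, eq_comm (a := j)]
          split_ifs <;> simp)
  convert key.symm using 1
  simp only [colLift]
  split_ifs <;> simp

end PathWeight

/-- the path-swapping involution identity
`w(K₁L₁)·w(K₂L₂) = q·w(K₁L₂)·w(K₂L₁)`. -/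
theorem involution_weight_identity {R : Type u} [Ring R] {m n : ℕ} (D : QMData R m n)
    (white : Fin m → Fin n → Bool) (hC : IsCauchon white)
    (xi : Fin m) (xj : Fin n) (hx : white xi xj = true)
    (u1 u2 : CVertex m n) (a b : Fin n)
    (K1 K2 L1 L2 : List (CVertex m n))
    (hK1 : IsPathFrom white u1 (.sq xi xj) K1)
    (hK2 : IsPathFrom white u2 (.sq xi xj) K2)
    (hK2h : ∃ p ∈ steps K2, Horiz p.1 p.2)
    (hL1 : IsPathFrom white (.sq xi xj) (.col a) L1)
    (hL2 : IsPathFrom white (.sq xi xj) (.col b) L2)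
    (hshare : ∀ y : CVertex m n, y ∈ L1 → y ∈ L2 → y = CVertex.sq xi xj)
    (hL1h : ∃ c d rest, L1 = c :: d :: rest ∧ Horiz c d)
    (hL2v : ∃ c d rest, L2 = c :: d :: rest ∧ ¬ Horiz c d) :
    pathWeight D (K1 ++ L1.tail) * pathWeight D (K2 ++ L2.tail) =
      ↑D.q * (pathWeight D (K1 ++ L2.tail) * pathWeight D (K2 ++ L1.tail)) := by
  obtain ⟨_, d, rest, rfl, hd⟩ := hL1h
  obtain ⟨_, y, rest', rfl, hy⟩ := hL2v
  obtain ⟨rfl, hed, htail⟩ := IsPathFrom.cons_iff.1 hL1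
  obtain ⟨rfl, hey, htail'⟩ := IsPathFrom.cons_iff.1 hL2
  have hcross : ∀ w ∈ d :: rest, match w with
      | .sq i j => xi ≤ i ∧ j < xj ∧
        ∀ r c, CVertex.sq r c ∈ CVertex.sq xi xj :: y :: rest' → r ≤ i → j < c
      | .col c => c < xj
      | .row _ => False := by
    refine htail.forward ?_ ?_
    · cases hed with
      | toCol => exact hd.elim
      | vert _ _ _ h => exact (h.ne hd).elim
      | horiz _ _ j h =>
        refine ⟨le_rfl, h, fun r c hm hr => ?_⟩
        rcases List.mem_cons.1 hm with heq | hm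
        · cases heq
          exact h
        · cases hey with
          | toCol =>
            cases rest' with
            | nil => simp at hm
            | cons z l => cases (IsPathFrom.cons_iff.1 htail').2.1
          | horiz => exact (hy rfl).elim
          | vert _ _ _ h' => exact absurd ((htail'.southWest _ hm).1.trans hr) h'.not_ge
    · rintro w - w' hw' he hw
      cases he with
      | fromRow => exact hw.elim
      | toCol => exact hw.2.1
      | horiz i k j h hwk hwj hb =>
        refine ⟨hw.1, h.trans hw.2.1,
          hL2.left_of_edge hC hw.1 hw.2.2 (.horiz i k j h hwk hwj hb) fun hmem => ?_⟩
        cases hshare _ (List.mem_cons_of_mem _ hw') hmem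
        exact (h.trans hw.2.1).false
      | vert i i' j h hwi hwi' hb =>
        refine ⟨hw.1.trans h.le, hw.2.1,
          hL2.left_of_edge hC hw.1 hw.2.2 (.vert i i' j h hwi hwi' hb) fun hmem => ?_⟩
        cases hshare _ (List.mem_cons_of_mem _ hw') hmem
        exact hw.2.1.false
  have hax : a < xj := hcross _ htail.last_mem
  have hbx : b ≤ xj := hL2.southWest _ hL2.last_mem
  have hab : a ≠ b := by
    rintro rfl
    cases hshare _ hL1.last_mem hL2.last_mem
  have hNE : ∀ {e : Fin n} {L : List (CVertex m n)}, IsPathFrom white (.sq xi xj) (.col e) L →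
      ∀ i j, NorthEast xi xj (.sq i j) → D.QComm (D.t i j : R) (pathWeight D L)
        ((if j = e then 1 else 0) - if j = xj then 1 else 0) := by
    intro e L hL i j hij
    exact hL.qComm_t (fun r c hm hr => absurd ((hL.southWest _ hm).1.trans_lt hr) hij.1.not_gt)
      (.inr fun c hm => (hL.southWest _ hm).2.trans hij.2)
  have hKP := hK2.qComm_of_col _ fun i j hm => hNE hL1 i j (hK2.northEast _ hm)
  have hKQ := hK2.qComm_of_col _ fun i j hm => hNE hL2 i j (hK2.northEast _ hm)
  have hPQ := hL1.qComm_of_col (D := D) (Y := pathWeight D (.sq xi xj :: y :: rest'))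
    (fun j => (if j = b then 1 else 0) - if j = xj then 1 else 0) (by
      intro i j hm
      rcases List.mem_cons.1 hm with heq | hm
      · cases heq
        exact hNE hL2 _ _ ⟨le_rfl, le_rfl⟩
      · have h := (hcross _ hm).2.2
        exact hL2.qComm_t (fun r c hm hr => h r c hm hr.le) (.inl fun c hm => h i c hm le_rfl))
  have hsrc : ∀ e ≤ xj, colLift
      (fun j => (if j = e then (1 : ℤ) else 0) - if j = xj then 1 else 0) u2 = 0 := by
    intro e he
    rcases hK2.source_of_horiz hK2h with ⟨r, rfl⟩ | ⟨r, k, rfl, hk⟩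
    · rfl
    · simp [colLift, hk.ne', (he.trans_lt hk).ne']
  rw [hsrc a hax.le] at hKP
  rw [hsrc b hbx] at hKQ
  simp only [colLift, hax.ne', hax.ne, hab, if_true, if_false] at hKP hKQ hPQ
  rw [hK1.pathWeight_append D hL1, hK1.pathWeight_append D hL2, hK2.pathWeight_append D hL1,
    hK2.pathWeight_append D hL2]
  generalize pathWeight D K1 = A at *
  generalize pathWeight D K2 = B at *
  generalize pathWeight D (.sq xi xj :: d :: rest) = P at *
  generalize pathWeight D (.sq xi xj :: y :: rest') = Q at *
  have hPB : P * B = D.q * (B * P) := by simpa [QMData.QComm] using hKP.symm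
  have hPBQ : P * B * Q = Q * (P * B) := by
    have h := hPQ.mul_left hKQ
    simpa [QMData.QComm] using h
  calc A * P * (B * Q) = A * (P * B * Q) := by simp only [mul_assoc]
    _ = A * Q * D.q * (B * P) := by rw [hPBQ, hPB]; simp only [mul_assoc]
    _ = D.q * (A * Q * (B * P)) := by rw [← D.q_central]; simp only [mul_assoc]
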